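/- Let μ₁, μ₂, μ₃, μ₄ be positive Borel measures on ℝ, each finite on every bounded Borel set, and set μ := μ₁ − μ₂ + i(μ₃ − μ₄) (a complex measure on every bounded Borel set). Suppose u : ℝ → ℂ is locally Lebesgue-integrable and its distributional derivative equals μ, i.e. −∫ φ'(x) u(x) dx = ∫ φ dμ for every φ ∈ C_c^∞(ℝ). Fix a ∈ ℝ and define f_μ(x) := μ([a,x]) for x ≥ a and f_μ(x) := −μ((x,a)) for x < a. Then there exists a constant c ∈ ℂ such that u(x) = c + f_μ(x) for Lebesgue-a.e. x ∈ ℝ; in particular u agrees a.e. with a right-continuous function of locally bounded variation. -/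

import Mathlib

open MeasureTheory

/-- Complex value `μ(s) = μ₁(s) - μ₂(s) + i(μ₃(s) - μ₄(s))` of the complex
combination of four positive measures on a (bounded) Borel set `s`. -/
noncomputable def cVal (μ₁ μ₂ μ₃ μ₄ : Measure ℝ) (s : Set ℝ) : ℂ :=
  (((μ₁ s).toReal - (μ₂ s).toReal : ℝ) : ℂ) +
    Complex.I * (((μ₃ s).toReal - (μ₄ s).toReal : ℝ) : ℂ)

/-- The function `f_μ(x) = μ([a,x])` for `x ≥ a`, `f_μ(x) = -μ((x,a))` for `x < a`. -/
noncomputable def fMu (μ₁ μ₂ μ₃ μ₄ : Measure ℝ) (a x : ℝ) : ℂ :=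
  if a ≤ x then cVal μ₁ μ₂ μ₃ μ₄ (Set.Icc a x) else - cVal μ₁ μ₂ μ₃ μ₄ (Set.Ioo x a)

/-- The real-valued primitive of a positive measure, normalized at `a`. -/
noncomputable def measurePrimitive (m : Measure ℝ) (a x : ℝ) : ℝ :=
  if a ≤ x then m.real (Set.Icc a x) else -m.real (Set.Ioo x a)

theorem isLocallyFiniteMeasure_of_Icc_lt_top {m : Measure ℝ}
    (h : ∀ r : ℝ, 0 < r → m (Set.Icc (-r) r) < ⊤) : IsLocallyFiniteMeasure m := by
  refine ⟨fun x => ⟨Set.Icc (-(|x| + 1)) (|x| + 1), ?_, h _ (by positivity)⟩⟩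
  refine Icc_mem_nhds ?_ ?_
  · linarith [neg_abs_le x]
  · linarith [le_abs_self x]

theorem measurePrimitive_monotone (m : Measure ℝ) [IsLocallyFiniteMeasure m] (a : ℝ) :
    Monotone (measurePrimitive m a) := by
  intro x y hxy
  unfold measurePrimitive
  split_ifs with hx hy hy
  · exact measureReal_mono (Set.Icc_subset_Icc_right hxy) isCompact_Icc.measure_lt_top.ne
  · exact absurd (hx.trans hxy) hy
  · exact (neg_nonpos.2 measureReal_nonneg).trans measureReal_nonneg
  · exact neg_le_neg (measureReal_mono (Set.Ioo_subset_Ioo_left hxy) measure_Ioo_lt_top.ne)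

/-- The kernel of the map sending a measure to its primitive. -/
noncomputable def primitiveKernel (a x y : ℝ) : ℝ :=
  (if a ≤ y ∧ y ≤ x then 1 else 0) - (if x < y ∧ y < a then 1 else 0)

theorem measurable_primitiveKernel (a : ℝ) :
    Measurable (fun p : ℝ × ℝ => primitiveKernel a p.1 p.2) := by
  unfold primitiveKernel
  refine Measurable.sub (Measurable.ite ?_ measurable_const measurable_const)
    (Measurable.ite ?_ measurable_const measurable_const)
  · exact (measurableSet_le measurable_const measurable_snd).inter
      (measurableSet_le measurable_snd measurable_fst)
  · exact (measurableSet_lt measurable_fst measurable_snd).inter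
      (measurableSet_lt measurable_snd measurable_const)

theorem integral_primitiveKernel (m : Measure ℝ) (a x : ℝ) :
    ∫ y, primitiveKernel a x y ∂m = measurePrimitive m a x := by
  unfold measurePrimitive
  split_ifs with hx
  · have : primitiveKernel a x = (Set.Icc a x).indicator 1 := by
      ext y
      simp only [primitiveKernel, Set.indicator, Set.mem_Icc, Pi.one_apply]
      rw [if_neg (fun h : x < y ∧ y < a => by linarith [h.1, h.2]), sub_zero]
    rw [this, integral_indicator_one measurableSet_Icc]
  · have : primitiveKernel a x = fun y => -(Set.Ioo x a).indicator 1 y := by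
      ext y
      simp only [primitiveKernel, Set.indicator, Set.mem_Ioo, Pi.one_apply]
      rw [if_neg (fun h : a ≤ y ∧ y ≤ x => hx (h.1.trans h.2)), zero_sub]
    rw [this, integral_neg, integral_indicator_one measurableSet_Ioo]

theorem integral_deriv_mul_primitiveKernel {φ : ℝ → ℝ} (hφ : ContDiff ℝ 1 φ)
    (hc : HasCompactSupport φ) (a y : ℝ) :
    ∫ x, deriv φ x * primitiveKernel a x y = -φ y := by
  rcases le_or_gt a y with hy | hy
  · have : (fun x => deriv φ x * primitiveKernel a x y) = (Set.Ici y).indicator (deriv φ) := by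
      ext x
      simp [primitiveKernel, Set.indicator, hy, not_lt.2 hy]
    rw [this, integral_indicator measurableSet_Ici, integral_Ici_eq_integral_Ioi,
      hc.integral_Ioi_deriv_eq hφ]
  · have : (fun x => deriv φ x * primitiveKernel a x y) =
        fun x => -(Set.Iio y).indicator (deriv φ) x := by
      ext x
      simp [primitiveKernel, Set.indicator, hy, not_le.2 hy]
    rw [this, integral_neg, integral_indicator measurableSet_Iio, ← integral_Iic_eq_integral_Iio,
      hc.integral_Iic_deriv_eq hφ]

theorem integrable_deriv_mul_primitiveKernel (m : Measure ℝ) [IsLocallyFiniteMeasure m]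
    {φ : ℝ → ℝ} (hφ : ContDiff ℝ 1 φ) (hc : HasCompactSupport φ) (a : ℝ) :
    Integrable (fun p : ℝ × ℝ => deriv φ p.1 * primitiveKernel a p.1 p.2) (volume.prod m) := by
  obtain ⟨R, hR⟩ := hc.deriv.isCompact.isBounded.subset_closedBall a
  have hint : Integrable (deriv φ) :=
    (hφ.continuous_deriv le_rfl).integrable_of_hasCompactSupport hc.deriv
  have hind : Integrable ((Metric.closedBall a R).indicator (1 : ℝ → ℝ)) m :=
    (integrable_indicator_iff Metric.isClosed_closedBall.measurableSet).2
      (integrableOn_const (isCompact_closedBall a R).measure_lt_top.ne)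
  refine (hint.norm.mul_prod hind).mono'
    (((hφ.continuous_deriv le_rfl).measurable.comp measurable_fst).mul
      (measurable_primitiveKernel a)).aestronglyMeasurable (Filter.Eventually.of_forall ?_)
  rintro ⟨x, y⟩
  rw [norm_mul]
  by_cases hx : deriv φ x = 0
  · simp [hx]
  refine mul_le_mul_of_nonneg_left ?_ (norm_nonneg _)
  have hxR : |x - a| ≤ R := hR (subset_tsupport _ hx)
  simp only [Set.indicator, Metric.mem_closedBall, Real.dist_eq, Pi.one_apply, primitiveKernel]
  rw [abs_le] at hxR
  simp only [abs_le]
  split_ifs with h₁ h₂ h₃ h₂ h₃ <;> norm_num <;> grind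

/-- The distributional derivative of the primitive of `m` is `m`. -/
theorem integral_deriv_mul_measurePrimitive (m : Measure ℝ) [IsLocallyFiniteMeasure m]
    {φ : ℝ → ℝ} (hφ : ContDiff ℝ 1 φ) (hc : HasCompactSupport φ) (a : ℝ) :
    ∫ x, deriv φ x * measurePrimitive m a x = -∫ y, φ y ∂m := by
  simp_rw [← integral_primitiveKernel, ← integral_const_mul]
  rw [integral_integral_swap (integrable_deriv_mul_primitiveKernel m hφ hc a)]
  simp_rw [integral_deriv_mul_primitiveKernel hφ hc, integral_neg]

/-- A test function of zero mean is the derivative of a test function. -/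
theorem exists_hasCompactSupport_deriv_eq {h : ℝ → ℝ} (hh : ContDiff ℝ (⊤ : ℕ∞) h)
    (hc : HasCompactSupport h) (h0 : ∫ x, h x = 0) :
    ∃ φ : ℝ → ℝ, ContDiff ℝ (⊤ : ℕ∞) φ ∧ HasCompactSupport φ ∧ deriv φ = h := by
  obtain ⟨R, hR⟩ := hc.isCompact.isBounded.subset_ball 0
  rw [Real.ball_eq_Ioo, zero_sub, zero_add] at hR
  have hs : Function.support h ⊆ Set.Ioo (-R) R := (subset_tsupport h).trans hR
  have hderiv : deriv (fun x => ∫ t in (-R)..x, h t) = h := by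
    ext x
    exact hh.continuous.deriv_integral h (-R) x
  refine ⟨fun x => ∫ t in (-R)..x, h t, ?_, ?_, hderiv⟩
  · rw [contDiff_infty_iff_deriv, hderiv]
    exact ⟨fun x => (intervalIntegral.integral_hasDerivAt_right
      (hh.continuous.intervalIntegrable _ _) (hh.continuous.stronglyMeasurableAtFilter _ _)
      hh.continuous.continuousAt).differentiableAt, hh⟩
  · refine HasCompactSupport.intro (K := Set.Icc (-R) R) isCompact_Icc fun x hx => ?_
    rw [Set.mem_Icc, not_and_or, not_le, not_le] at hx
    rcases hx with hx | hx
    · refine (intervalIntegral.integral_congr (g := fun _ => 0) fun t ht => ?_).trans (by simp)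
      rw [Set.uIcc_of_ge hx.le] at ht
      by_contra hne
      exact absurd (hs hne).1 (not_lt.2 ht.2)
    · rw [intervalIntegral.integral_eq_integral_of_support_subset, h0]
      exact fun t ht => ⟨(hs ht).1, (hs ht).2.le.trans hx.le⟩

/-- The du Bois-Reymond lemma: a locally integrable function on the line whose distributional
derivative vanishes is almost everywhere constant. -/
theorem ae_eq_const_of_integral_deriv_smul_eq_zero {E : Type*} [NormedAddCommGroup E]
    [NormedSpace ℝ E] [CompleteSpace E] {w : ℝ → E} (hw : LocallyIntegrable w)
    (h : ∀ φ : ℝ → ℝ, ContDiff ℝ (⊤ : ℕ∞) φ → HasCompactSupport φ →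
      ∫ x, deriv φ x • w x = 0) :
    ∃ c : E, ∀ᵐ x, w x = c := by
  let b : ContDiffBump (0 : ℝ) := ⟨1, 2, one_pos, one_lt_two⟩
  let ψ : ℝ → ℝ := b.normed volume
  have hψ : ContDiff ℝ (⊤ : ℕ∞) ψ := b.contDiff_normed
  have hψc : HasCompactSupport ψ := b.hasCompactSupport_normed
  have hψ1 : ∫ x, ψ x = 1 := b.integral_normed
  have hint {g : ℝ → ℝ} (hg : ContDiff ℝ (⊤ : ℕ∞) g) (hgc : HasCompactSupport g) :
      Integrable (fun x => g x • w x) :=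
    hw.integrable_smul_left_of_hasCompactSupport hg.continuous hgc
  refine ⟨∫ x, ψ x • w x, ?_⟩
  have key : ∀ᵐ x, w x - ∫ y, ψ y • w y = 0 := by
    refine ae_eq_zero_of_integral_contDiff_smul_eq_zero
      (hw.sub (locallyIntegrable_const _)) fun g hg hgc => ?_
    have hgi : Integrable g := hg.continuous.integrable_of_hasCompactSupport hgc
    have hψi : Integrable ψ := hψ.continuous.integrable_of_hasCompactSupport hψc
    obtain ⟨φ, hφ, hφc, hφd⟩ := exists_hasCompactSupport_deriv_eq
      (h := fun x => g x - (∫ y, g y) * ψ x) (hg.sub (contDiff_const.mul hψ))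
      (hgc.sub hψc.mul_left)
      (by rw [integral_sub hgi (hψi.const_mul _), integral_const_mul, hψ1, mul_one, sub_self])
    have hz := h φ hφ hφc
    simp_rw [hφd, sub_smul, mul_smul] at hz
    rw [integral_sub (hint hg hgc) ((hint hψ hψc).fun_smul _), integral_smul] at hz
    simp_rw [smul_sub]
    rw [integral_sub (hint hg hgc) (hgi.smul_const _), integral_smul_const]
    exact hz
  filter_upwards [key] with x hx using sub_eq_zero.1 hx

theorem fMu_eq_measurePrimitive (μ₁ μ₂ μ₃ μ₄ : Measure ℝ) (a x : ℝ) :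
    fMu μ₁ μ₂ μ₃ μ₄ a x =
      ((measurePrimitive μ₁ a x - measurePrimitive μ₂ a x : ℝ) : ℂ) +
        Complex.I * ((measurePrimitive μ₃ a x - measurePrimitive μ₄ a x : ℝ) : ℂ) := by
  unfold fMu measurePrimitive cVal Measure.real
  split_ifs <;> push_cast <;> ring

/-- fundamental theorem of calculus for BV functions
(Proposition 2.2): a locally integrable function whose distributional
derivative is the complex measure `μ = μ₁ - μ₂ + i(μ₃ - μ₄)` agrees a.e. with
`c + f_μ` for some constant `c`. -/
theorem ftc_bv
    (μ₁ μ₂ μ₃ μ₄ : Measure ℝ)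
    (hfin₁ : ∀ r : ℝ, 0 < r → μ₁ (Set.Icc (-r) r) < ⊤)
    (hfin₂ : ∀ r : ℝ, 0 < r → μ₂ (Set.Icc (-r) r) < ⊤)
    (hfin₃ : ∀ r : ℝ, 0 < r → μ₃ (Set.Icc (-r) r) < ⊤)
    (hfin₄ : ∀ r : ℝ, 0 < r → μ₄ (Set.Icc (-r) r) < ⊤)
    (u : ℝ → ℂ) (hu : LocallyIntegrable u volume)
    (hweak : ∀ φ : ℝ → ℝ, ContDiff ℝ (⊤ : ℕ∞) φ → HasCompactSupport φ →
      -(∫ x : ℝ, ((deriv φ x : ℝ) : ℂ) * u x)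
        = (((∫ x, φ x ∂μ₁) - ∫ x, φ x ∂μ₂ : ℝ) : ℂ) +
            Complex.I * (((∫ x, φ x ∂μ₃) - ∫ x, φ x ∂μ₄ : ℝ) : ℂ))
    (a : ℝ) :
    ∃ c : ℂ, ∀ᵐ x : ℝ ∂volume, u x = c + fMu μ₁ μ₂ μ₃ μ₄ a x := by
  have := isLocallyFiniteMeasure_of_Icc_lt_top hfin₁
  have := isLocallyFiniteMeasure_of_Icc_lt_top hfin₂
  have := isLocallyFiniteMeasure_of_Icc_lt_top hfin₃
  have := isLocallyFiniteMeasure_of_Icc_lt_top hfin₄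
  have hprim (m : Measure ℝ) [IsLocallyFiniteMeasure m] :
      LocallyIntegrable (fun x => (measurePrimitive m a x : ℂ)) := fun x =>
    let ⟨s, hs, hi⟩ := (measurePrimitive_monotone m a).locallyIntegrable x
    ⟨s, hs, hi.ofReal⟩
  have hf : fMu μ₁ μ₂ μ₃ μ₄ a = fun x =>
      ((measurePrimitive μ₁ a x : ℂ) - measurePrimitive μ₂ a x) +
        Complex.I • ((measurePrimitive μ₃ a x : ℂ) - measurePrimitive μ₄ a x) := by
    ext x
    rw [fMu_eq_measurePrimitive]
    push_cast
    rfl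
  have hfl : LocallyIntegrable (fMu μ₁ μ₂ μ₃ μ₄ a) := by
    rw [hf]
    exact ((hprim μ₁).sub (hprim μ₂)).add (((hprim μ₃).sub (hprim μ₄)).smul Complex.I)
  obtain ⟨c, hc⟩ := ae_eq_const_of_integral_deriv_smul_eq_zero (hu.sub hfl) fun φ hφ hφc => by
    have hφ1 : ContDiff ℝ 1 φ := hφ.of_le (by exact_mod_cast le_top)
    have hint {w : ℝ → ℂ} (hw : LocallyIntegrable w) : Integrable (fun x => deriv φ x • w x) :=
      hw.integrable_smul_left_of_hasCompactSupport (hφ1.continuous_deriv le_rfl) hφc.deriv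
    have hI (m : Measure ℝ) [IsLocallyFiniteMeasure m] :
        ∫ x, deriv φ x • (measurePrimitive m a x : ℂ) = -((∫ x, φ x ∂m : ℝ) : ℂ) := by
      rw [← Complex.ofReal_neg, ← integral_deriv_mul_measurePrimitive m hφ1 hφc a,
        ← integral_complex_ofReal]
      simp
    have hF : ∫ x, deriv φ x • fMu μ₁ μ₂ μ₃ μ₄ a x = ∫ x, ((deriv φ x : ℝ) : ℂ) * u x := by
      rw [← neg_inj, hweak φ hφ hφc, hf]
      simp_rw [smul_add, smul_comm (deriv φ _) Complex.I, smul_sub]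
      have h₁ := hint (hprim μ₁)
      have h₂ := hint (hprim μ₂)
      have h₃ := hint (hprim μ₃)
      have h₄ := hint (hprim μ₄)
      rw [integral_add (h₁.sub' h₂) ((h₃.fun_smul Complex.I).sub' (h₄.fun_smul Complex.I)),
        integral_sub h₁ h₂, integral_sub (h₃.fun_smul Complex.I) (h₄.fun_smul Complex.I),
        integral_smul, integral_smul, hI, hI, hI, hI]
      push_cast
      simp only [smul_eq_mul]
      ring
    simp_rw [Pi.sub_apply, smul_sub]
    rw [integral_sub (hint hu) (hint hfl), hF]
    simp
  exact ⟨c, hc.mono fun x hx => eq_add_of_sub_eq hx⟩
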